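/- arXiv:2605.28776 — 4 statements merged into one kernel-verified Lean document; each statement's English description precedes it below -/
import Mathlib

section
/- For c ∈ ℝ and integers n ≥ 4, define A_n(c) := ∑_{2 ≤ i < j < k ≤ n} (log i)^c / ( i · j · k · (log k)^c ). Then there exist constants 0 < c₁ ≤ C₁ and an integer n₀ ≥ 4, all depending only on c, such that for all n ≥ n₀: if c > −1 then c₁ (log n)³ ≤ A_n(c) ≤ C₁ (log n)³; if c = −1 then c₁ (log n)³ log log n ≤ A_n(c) ≤ C₁ (log n)³ log log n; and if c < −1 then c₁ (log n)^{2−c} ≤ A_n(c) ≤ C₁ (log n)^{2−c}. -/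
open Real

/-- `A_n(c) = ∑_{2 ≤ i < j < k ≤ n} (log i)^c / (i·j·k·(log k)^c)`. -/
noncomputable def Asum (c : ℝ) (n : ℕ) : ℝ :=
  ∑ i ∈ Finset.Icc 2 n, ∑ j ∈ Finset.Ioc i n, ∑ k ∈ Finset.Ioc j n,
    (Real.log i) ^ c / ((i : ℝ) * (j : ℝ) * (k : ℝ) * (Real.log k) ^ c)

open Finset in
/-- Sums of an antitone function are bounded above by increments of a primitive. -/
theorem sum_Ioc_le_sub_of_antitoneOn {F a : ℝ → ℝ}
    (hF : ∀ x, 1 < x → HasDerivAt F (a x) x) (ha : AntitoneOn a (Set.Ioi 1))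
    {m n : ℕ} (hm : 2 ≤ m) (hmn : m ≤ n) :
    ∑ i ∈ Ioc m n, a i ≤ F n - F m := by
  induction n, hmn using Nat.le_induction with
  | base => simp
  | succ k hk ih =>
    rw [Finset.sum_Ioc_succ_top hk]
    have hk1 : (1 : ℝ) < k := by exact_mod_cast (by omega : 1 < k)
    obtain ⟨x, hx, hx'⟩ := exists_hasDerivAt_eq_slope F a
      (show (k : ℝ) < ((k + 1 : ℕ) : ℝ) by push_cast; linarith)
      (fun x hx => (hF x (hk1.trans_le hx.1)).continuousAt.continuousWithinAt)
      (fun x hx => hF x (hk1.trans hx.1))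
    have h := ha (show x ∈ Set.Ioi 1 from hk1.trans hx.1)
      (show ((k + 1 : ℕ) : ℝ) ∈ Set.Ioi 1 from (hk1.trans hx.1).trans hx.2) hx.2.le
    rw [hx'] at h
    push_cast at h ⊢
    rw [add_sub_cancel_left, div_one] at h
    linarith

open Finset in
/-- Sums of an antitone function are bounded below by increments of a primitive. -/
theorem sub_le_sum_Ioc_of_antitoneOn {F a : ℝ → ℝ}
    (hF : ∀ x, 1 < x → HasDerivAt F (a x) x) (ha : AntitoneOn a (Set.Ioi 1))
    {m n : ℕ} (hm : 1 ≤ m) (hmn : m ≤ n) :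
    F (n + 1) - F (m + 1) ≤ ∑ i ∈ Ioc m n, a i := by
  induction n, hmn using Nat.le_induction with
  | base => simp
  | succ k hk ih =>
    rw [Finset.sum_Ioc_succ_top hk]
    have hk1 : (1 : ℝ) < ((k + 1 : ℕ) : ℝ) := by exact_mod_cast (by omega : 1 < k + 1)
    obtain ⟨x, hx, hx'⟩ := exists_hasDerivAt_eq_slope F a
      (show ((k + 1 : ℕ) : ℝ) < ((k + 1 : ℕ) : ℝ) + 1 by linarith)
      (fun x hx => (hF x (hk1.trans_le hx.1)).continuousAt.continuousWithinAt)
      (fun x hx => hF x (hk1.trans hx.1))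
    have h := ha (show ((k + 1 : ℕ) : ℝ) ∈ Set.Ioi 1 from hk1)
      (show x ∈ Set.Ioi 1 from hk1.trans hx.1) hx.1.le
    rw [hx', add_sub_cancel_left, div_one] at h
    push_cast at h ⊢
    linarith

theorem antitoneOn_log_rpow_div {c : ℝ} (hc : c ≤ 0) :
    AntitoneOn (fun x : ℝ => log x ^ c / x) (Set.Ioi 1) := by
  intro x hx y hy hxy
  have hx0 : (0 : ℝ) < x := one_pos.trans hx
  have hlx := log_pos hx
  exact div_le_div₀ (rpow_nonneg hlx.le c)
    (rpow_le_rpow_of_nonpos hlx (log_le_log hx0 hxy) hc) hx0 hxy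

theorem hasDerivAt_log_rpow_div {c : ℝ} (hc : c + 1 ≠ 0) {x : ℝ} (hx : 1 < x) :
    HasDerivAt (fun x : ℝ => log x ^ (c + 1) / (c + 1)) (log x ^ c / x) x := by
  have h := ((hasDerivAt_log (one_pos.trans hx).ne').rpow_const (p := c + 1)
    (Or.inl (log_pos hx).ne')).div_const (c + 1)
  refine h.congr_deriv ?_
  rw [add_sub_cancel_right]
  field_simp

theorem hasDerivAt_log_log {x : ℝ} (hx : 1 < x) :
    HasDerivAt (fun x : ℝ => log (log x)) (log x ^ (-1 : ℝ) / x) x := by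
  have h := (hasDerivAt_log (one_pos.trans hx).ne').log (log_pos hx).ne'
  refine h.congr_deriv ?_
  rw [rpow_neg_one]
  field_simp

theorem antitoneOn_one_div_Ioi_one : AntitoneOn (fun x : ℝ => 1 / x) (Set.Ioi 1) :=
  fun _ hx _ _ hxy => one_div_le_one_div_of_le (one_pos.trans hx) hxy

theorem hasDerivAt_log_one_div {x : ℝ} (hx : 1 < x) : HasDerivAt log (1 / x) x := by
  simpa using hasDerivAt_log (one_pos.trans hx).ne'

theorem sum_Icc_two_eq_add_sum_Ioc (a : ℕ → ℝ) {n : ℕ} (hn : 2 ≤ n) :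
    ∑ i ∈ Finset.Icc 2 n, a i = a 2 + ∑ i ∈ Finset.Ioc 2 n, a i :=
  (Finset.add_sum_Ioc_eq_sum_Icc hn).symm

theorem sum_Icc_two_one_div_le_log {n : ℕ} (hn : 2 ≤ n) :
    ∑ i ∈ Finset.Icc 2 n, (1 : ℝ) / i ≤ log n := by
  rw [sum_Icc_two_eq_add_sum_Ioc (fun i => (1 : ℝ) / i) hn]
  have h := sum_Ioc_le_sub_of_antitoneOn (fun x hx => hasDerivAt_log_one_div hx)
    antitoneOn_one_div_Ioi_one le_rfl hn
  have := log_two_gt_d9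
  push_cast at h ⊢
  linarith

/-- The integer part of `n ^ s`. -/
noncomputable def floorPow (s : ℝ) (n : ℕ) : ℕ := ⌊exp (s * log n)⌋₊

theorem floorPow_mono {s t : ℝ} (hst : s ≤ t) (n : ℕ) : floorPow s n ≤ floorPow t n :=
  Nat.floor_le_floor (exp_le_exp.2 (mul_le_mul_of_nonneg_right hst (log_natCast_nonneg n)))

theorem floorPow_one {n : ℕ} (hn : 0 < n) : floorPow 1 n = n := by
  rw [floorPow, one_mul, exp_log (by exact_mod_cast hn), Nat.floor_natCast]

theorem one_le_floorPow {s : ℝ} (hs : 0 ≤ s) (n : ℕ) : 1 ≤ floorPow s n :=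
  Nat.le_floor (by simpa using mul_nonneg hs (log_natCast_nonneg n))

theorem mul_log_le_log_of_floorPow_lt {s : ℝ} {n k : ℕ} (hk : floorPow s n < k) :
    s * log n ≤ log k := by
  have h := Nat.lt_of_floor_lt hk
  exact (le_log_iff_exp_le ((exp_pos _).trans h)).2 h.le

theorem mul_log_le_log_floorPow_add_one (s : ℝ) (n : ℕ) :
    s * log n ≤ log (floorPow s n + 1) := by
  simpa using mul_log_le_log_of_floorPow_lt (Nat.lt_succ_self (floorPow s n))

theorem log_floorPow_add_one_le {s : ℝ} (hs : 0 ≤ s) (n : ℕ) :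
    log (floorPow s n + 1) ≤ s * log n + 1 := by
  have h1 : (floorPow s n : ℝ) ≤ exp (s * log n) := Nat.floor_le (exp_pos _).le
  have h2 : 1 ≤ exp (s * log n) := one_le_exp (mul_nonneg hs (log_natCast_nonneg n))
  rw [log_le_iff_le_exp (by positivity), exp_add]
  nlinarith [add_one_le_exp (1 : ℝ)]

theorem log_div_eight_le_sum_Ioc_floorPow {s t : ℝ} (hs : 0 ≤ s) (hst : t = s + 1 / 4) {n : ℕ}
    (hn : 8 ≤ log n) :
    log n / 8 ≤ ∑ i ∈ Finset.Ioc (floorPow s n) (floorPow t n), (1 : ℝ) / i := by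
  have h := sub_le_sum_Ioc_of_antitoneOn (fun x hx => hasDerivAt_log_one_div hx)
    antitoneOn_one_div_Ioi_one (one_le_floorPow hs n) (floorPow_mono (by linarith : s ≤ t) n)
  have h1 := log_floorPow_add_one_le hs n
  have h2 := mul_log_le_log_floorPow_add_one t n
  subst hst
  linarith

theorem min_mul_rpow_le_rpow {c x L : ℝ} (hL : 0 < L) (hx : 1 / 4 * L ≤ x) (hxL : x ≤ L) :
    min 1 ((1 / 4 : ℝ) ^ c) * L ^ c ≤ x ^ c := by
  have hLc : 0 ≤ L ^ c := rpow_nonneg hL.le c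
  rcases le_total 0 c with hc | hc
  · calc min 1 ((1 / 4 : ℝ) ^ c) * L ^ c ≤ (1 / 4 : ℝ) ^ c * L ^ c := by
          gcongr; exact min_le_right _ _
      _ = (1 / 4 * L) ^ c := (mul_rpow (by norm_num) hL.le).symm
      _ ≤ x ^ c := rpow_le_rpow (by positivity) hx hc
  · calc min 1 ((1 / 4 : ℝ) ^ c) * L ^ c ≤ 1 * L ^ c := by
          gcongr; exact min_le_left _ _
      _ = L ^ c := one_mul _
      _ ≤ x ^ c := rpow_le_rpow_of_nonpos (by linarith) hxL hc

theorem two_le_of_eight_le_log {n : ℕ} (hn : 8 ≤ log n) : 2 ≤ n := by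
  by_contra! h
  interval_cases n <;> norm_num at hn

theorem Asum_term_eq (c : ℝ) (i j k : ℕ) :
    log i ^ c / ((i : ℝ) * j * k * log k ^ c)
      = (log i ^ c / i) * ((1 / j) * ((1 / k) * log k ^ (-c))) := by
  rw [rpow_neg (log_natCast_nonneg k)]
  simp only [div_eq_mul_inv, mul_inv, one_mul]
  ring

theorem Asum_term_nonneg (c : ℝ) (i j k : ℕ) :
    0 ≤ log i ^ c / ((i : ℝ) * j * k * log k ^ c) := by
  have := rpow_nonneg (log_natCast_nonneg i) c
  have := rpow_nonneg (log_natCast_nonneg k) c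
  positivity

/-- The ordering constraint may be dropped in upper bounds for sums of products. -/
theorem Asum_le_of_term_le {c : ℝ} {n : ℕ} {a b d : ℕ → ℝ} (ha : ∀ i, 0 ≤ a i)
    (hb : ∀ i, 0 ≤ b i) (hd : ∀ i, 0 ≤ d i)
    (h : ∀ i j k : ℕ, 2 ≤ i → i < j → j < k → k ≤ n →
      log i ^ c / ((i : ℝ) * j * k * log k ^ c) ≤ a i * (b j * d k)) :
    Asum c n ≤ (∑ i ∈ Finset.Icc 2 n, a i) *
      ((∑ j ∈ Finset.Icc 2 n, b j) * ∑ k ∈ Finset.Icc 2 n, d k) := by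
  unfold Asum
  rw [Finset.sum_mul]
  refine Finset.sum_le_sum fun i hi => ?_
  rw [Finset.mem_Icc] at hi
  rw [Finset.sum_mul, Finset.mul_sum]
  have hD : 0 ≤ ∑ k ∈ Finset.Icc 2 n, d k := Finset.sum_nonneg fun k _ => hd k
  refine le_trans (Finset.sum_le_sum fun j hj => ?_)
    (Finset.sum_le_sum_of_subset_of_nonneg
      (f := fun j => a i * (b j * ∑ k ∈ Finset.Icc 2 n, d k)) (s := Finset.Ioc i n) ?_
      fun j _ _ => mul_nonneg (ha i) (mul_nonneg (hb j) hD))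
  · rw [Finset.mem_Ioc] at hj
    rw [Finset.mul_sum, Finset.mul_sum]
    refine le_trans (Finset.sum_le_sum fun k hk => ?_)
      (Finset.sum_le_sum_of_subset_of_nonneg (f := fun k => a i * (b j * d k))
        (s := Finset.Ioc j n) ?_ fun k _ _ => mul_nonneg (ha i) (mul_nonneg (hb j) (hd k)))
    · rw [Finset.mem_Ioc] at hk
      exact h i j k hi.1 hj.1 hk.1 hk.2
    · intro k hk
      simp only [Finset.mem_Ioc, Finset.mem_Icc] at hk ⊢
      omega
  · intro j hj
    simp only [Finset.mem_Ioc, Finset.mem_Icc] at hj ⊢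
    omega

theorem Asum_le_of_nonneg {c : ℝ} (hc : 0 ≤ c) {n : ℕ} (hn : 2 ≤ n) :
    Asum c n ≤ log n ^ 3 := by
  have hH := sum_Icc_two_one_div_le_log hn
  have hH0 : 0 ≤ ∑ i ∈ Finset.Icc 2 n, (1 : ℝ) / i := Finset.sum_nonneg fun i _ => by positivity
  have h := Asum_le_of_term_le (c := c) (n := n) (a := fun i => 1 / i) (b := fun i => 1 / i)
    (d := fun i => 1 / i) (fun i => by positivity) (fun i => by positivity)
    (fun i => by positivity) ?_
  · refine h.trans ?_
    calc _ ≤ log n * (log n * log n) := by gcongr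
      _ = log n ^ 3 := by ring
  · intro i j k hi hij hjk hk
    have hi0 : (0 : ℝ) < i := by exact_mod_cast (by omega : 0 < i)
    have hlk : 0 < log k := log_pos (by exact_mod_cast (by omega : 1 < k))
    have h1 : log i ^ c ≤ log k ^ c := by
      refine rpow_le_rpow (log_natCast_nonneg i) (log_le_log hi0 ?_) hc
      exact_mod_cast (by omega : i ≤ k)
    have hkc : 0 < log k ^ c := rpow_pos_of_pos hlk c
    calc log i ^ c / ((i : ℝ) * j * k * log k ^ c)
        ≤ log k ^ c / ((i : ℝ) * j * k * log k ^ c) := by gcongr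
      _ = 1 / i * (1 / j * (1 / k)) := by
        rw [div_mul_cancel_right₀ hkc.ne']
        simp only [one_div, mul_inv, mul_assoc]

theorem Asum_le_of_nonpos {c : ℝ} (hc : c ≤ 0) {n : ℕ} (hn : 2 ≤ n) :
    Asum c n ≤ log n ^ (2 - c) * ∑ i ∈ Finset.Icc 2 n, log i ^ c / i := by
  have hH := sum_Icc_two_one_div_le_log hn
  have hH0 : 0 ≤ ∑ i ∈ Finset.Icc 2 n, (1 : ℝ) / i := Finset.sum_nonneg fun i _ => by positivity
  have hL : 0 < log n := log_pos (by exact_mod_cast (by omega : 1 < n))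
  have hLc : 0 < log n ^ (-c) := rpow_pos_of_pos hL _
  have ha : ∀ i : ℕ, 0 ≤ log i ^ c / i := fun i =>
    div_nonneg (rpow_nonneg (log_natCast_nonneg i) c) i.cast_nonneg
  have h := Asum_le_of_term_le (c := c) (n := n) (a := fun i => log i ^ c / i)
    (b := fun i => 1 / i) (d := fun i => 1 / i * log n ^ (-c)) ha (fun i => by positivity)
    (fun i => by positivity) ?_
  · refine h.trans ?_
    rw [← Finset.sum_mul, mul_comm]
    refine mul_le_mul_of_nonneg_right ?_ (Finset.sum_nonneg fun i _ => ha i)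
    calc _ ≤ log n * (log n * log n ^ (-c)) := by gcongr
      _ = log n ^ (2 - c) := by
        rw [sub_eq_add_neg, rpow_add hL, rpow_two]; ring
  · intro i j k hi hij hjk hk
    rw [Asum_term_eq]
    have hk0 : (0 : ℝ) < k := by exact_mod_cast (by omega : 0 < k)
    have : log k ^ (-c) ≤ log n ^ (-c) :=
      rpow_le_rpow (log_natCast_nonneg k) (log_le_log hk0 (by exact_mod_cast hk)) (by linarith)
    have := ha i
    gcongr

theorem le_Asum {c : ℝ} {n : ℕ} (hn : 8 ≤ log n) :
    min 1 ((1 / 4 : ℝ) ^ (-c)) / 64 * log n ^ (2 - c) *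
      ∑ i ∈ Finset.Icc 2 (floorPow (1 / 2) n), log i ^ c / i ≤ Asum c n := by
  have hL : 0 < log n := by linarith
  have hn2 := two_le_of_eight_le_log hn
  set κ := min 1 ((1 / 4 : ℝ) ^ (-c))
  have hκ : 0 ≤ κ * log n ^ (-c) := by positivity
  have ha : ∀ i : ℕ, 0 ≤ log i ^ c / i := fun i =>
    div_nonneg (rpow_nonneg (log_natCast_nonneg i) c) i.cast_nonneg
  have hH1 := log_div_eight_le_sum_Ioc_floorPow (s := 1 / 2) (t := 3 / 4)
    (by norm_num) (by norm_num) hn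
  have hH2 := log_div_eight_le_sum_Ioc_floorPow (s := 3 / 4) (t := 1)
    (by norm_num) (by norm_num) hn
  have hmp : floorPow (1 / 2) n ≤ floorPow (3 / 4) n := floorPow_mono (by norm_num) n
  have hpn : floorPow (3 / 4) n ≤ floorPow 1 n := floorPow_mono (by norm_num) n
  rw [floorPow_one (by omega)] at hH2 hpn
  set m := floorPow (1 / 2) n
  set p := floorPow (3 / 4) n
  set T := ∑ i ∈ Finset.Icc 2 m, log i ^ c / i with hT
  have hT0 : 0 ≤ T := Finset.sum_nonneg fun i _ => ha i
  calc κ / 64 * log n ^ (2 - c) * T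
      = T * ((log n / 8) * ((log n / 8) * (κ * log n ^ (-c)))) := by
        rw [sub_eq_add_neg, rpow_add hL, rpow_two]; ring
    _ ≤ T * ((∑ j ∈ Finset.Ioc m p, (1 : ℝ) / j) *
          ((∑ k ∈ Finset.Ioc p n, (1 : ℝ) / k) * (κ * log n ^ (-c)))) := by gcongr
    _ = ∑ i ∈ Finset.Icc 2 m, ∑ j ∈ Finset.Ioc m p, ∑ k ∈ Finset.Ioc p n,
          (log i ^ c / i) * ((1 / j) * ((1 / k) * (κ * log n ^ (-c)))) := by
        rw [hT, Finset.sum_mul]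
        refine Finset.sum_congr rfl fun i _ => ?_
        rw [Finset.sum_mul, Finset.mul_sum]
        refine Finset.sum_congr rfl fun j _ => ?_
        rw [Finset.sum_mul, Finset.mul_sum, Finset.mul_sum]
    _ ≤ ∑ i ∈ Finset.Icc 2 m, ∑ j ∈ Finset.Ioc m p, ∑ k ∈ Finset.Ioc p n,
          log i ^ c / ((i : ℝ) * j * k * log k ^ c) := by
        refine Finset.sum_le_sum fun i _ => Finset.sum_le_sum fun j _ =>
          Finset.sum_le_sum fun k hk => ?_
        rw [Finset.mem_Ioc] at hk
        rw [Asum_term_eq]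
        have hk0 : (0 : ℝ) < k := by exact_mod_cast (by omega : 0 < k)
        have hlk := mul_log_le_log_of_floorPow_lt hk.1
        have hkn := min_mul_rpow_le_rpow (c := -c) hL (by linarith : 1 / 4 * log n ≤ log k)
          (log_le_log hk0 (by exact_mod_cast hk.2))
        have := ha i
        gcongr
    _ ≤ Asum c n := by
        refine (Finset.sum_le_sum fun i hi => ?_).trans
          (Finset.sum_le_sum_of_subset_of_nonneg
            (Finset.Icc_subset_Icc_right (hmp.trans hpn)) fun i _ _ =>
            Finset.sum_nonneg fun j _ => Finset.sum_nonneg fun k _ => Asum_term_nonneg c i j k)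
        rw [Finset.mem_Icc] at hi
        refine (Finset.sum_le_sum fun j hj => ?_).trans
          (Finset.sum_le_sum_of_subset_of_nonneg
            (Finset.Ioc_subset_Ioc hi.2 hpn) fun j _ _ =>
            Finset.sum_nonneg fun k _ => Asum_term_nonneg c i j k)
        rw [Finset.mem_Ioc] at hj
        exact Finset.sum_le_sum_of_subset_of_nonneg (Finset.Ioc_subset_Ioc_left hj.2)
          fun k _ _ => Asum_term_nonneg c i j k

theorem le_sum_log_rpow_div {c : ℝ} {n : ℕ} (hn : 8 ≤ log n) :
    min 1 ((1 / 4 : ℝ) ^ c) / 8 * log n ^ (c + 1) ≤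
      ∑ i ∈ Finset.Icc 2 (floorPow (1 / 2) n), log i ^ c / i := by
  have hL : 0 < log n := by linarith
  have hn2 := two_le_of_eight_le_log hn
  have hH := log_div_eight_le_sum_Ioc_floorPow (s := 1 / 4) (t := 1 / 2)
    (by norm_num) (by norm_num) hn
  have hmn : floorPow (1 / 2) n ≤ floorPow 1 n := floorPow_mono (by norm_num) n
  rw [floorPow_one (by omega)] at hmn
  have h1 : 1 ≤ floorPow (1 / 4) n := one_le_floorPow (by norm_num) n
  set κ := min 1 ((1 / 4 : ℝ) ^ c)
  have hκ : 0 ≤ κ * log n ^ c := by positivity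
  calc κ / 8 * log n ^ (c + 1) = κ * log n ^ c * (log n / 8) := by
        rw [rpow_add hL, rpow_one]; ring
    _ ≤ κ * log n ^ c * ∑ i ∈ Finset.Ioc (floorPow (1 / 4) n) (floorPow (1 / 2) n),
          (1 : ℝ) / i := by gcongr
    _ ≤ ∑ i ∈ Finset.Ioc (floorPow (1 / 4) n) (floorPow (1 / 2) n), log i ^ c / i := by
        rw [Finset.mul_sum]
        refine Finset.sum_le_sum fun i hi => ?_
        rw [Finset.mem_Ioc] at hi
        rw [mul_one_div]
        have hi0 : (0 : ℝ) < i := by exact_mod_cast (by omega : 0 < i)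
        have := min_mul_rpow_le_rpow (c := c) hL (mul_log_le_log_of_floorPow_lt hi.1)
          (log_le_log hi0 (by exact_mod_cast hi.2.trans hmn))
        gcongr
    _ ≤ _ := by
        refine Finset.sum_le_sum_of_subset_of_nonneg (fun i hi => ?_) fun i _ _ =>
          div_nonneg (rpow_nonneg (log_natCast_nonneg i) c) i.cast_nonneg
        simp only [Finset.mem_Ioc, Finset.mem_Icc] at hi ⊢
        omega

theorem sum_log_rpow_div_le {c : ℝ} (hc : c ≤ 0) {F : ℝ → ℝ}
    (hF : ∀ x, 1 < x → HasDerivAt F (log x ^ c / x) x) {n : ℕ} (hn : 2 ≤ n) :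
    ∑ i ∈ Finset.Icc 2 n, log i ^ c / i ≤ log 2 ^ c / 2 + (F n - F 2) := by
  rw [sum_Icc_two_eq_add_sum_Ioc (fun i => log i ^ c / i) hn]
  have h := sum_Ioc_le_sub_of_antitoneOn hF (antitoneOn_log_rpow_div hc) le_rfl hn
  push_cast at h ⊢
  linarith

theorem Asum_bounds_of_neg_one_lt {c : ℝ} (hc : -1 < c) :
    ∃ a A : ℝ, 0 < a ∧ ∀ n : ℕ, 8 ≤ log n →
      a * log n ^ 3 ≤ Asum c n ∧ Asum c n ≤ A * log n ^ 3 := by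
  have hpow : ∀ n : ℕ, 8 ≤ log n → log n ^ (2 - c) * log n ^ (c + 1) = log n ^ 3 := by
    intro n hn
    rw [← rpow_add (by linarith), ← rpow_natCast]
    congr 1
    push_cast
    ring
  have hlower : ∀ n : ℕ, 8 ≤ log n →
      min 1 ((1 / 4 : ℝ) ^ (-c)) / 64 * (min 1 ((1 / 4 : ℝ) ^ c) / 8) * log n ^ 3
        ≤ Asum c n := by
    intro n hn
    have hL : 0 < log n := by linarith
    refine le_trans ?_ (le_Asum hn)
    rw [← hpow n hn, mul_mul_mul_comm]
    exact mul_le_mul_of_nonneg_left (le_sum_log_rpow_div hn) (by positivity)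
  rcases le_total 0 c with hc0 | hc0
  · refine ⟨_, 1, by positivity, fun n hn => ⟨hlower n hn, ?_⟩⟩
    rw [one_mul]
    exact Asum_le_of_nonneg hc0 (two_le_of_eight_le_log hn)
  · refine ⟨_, log 2 ^ c / 2 + 1 / (c + 1), by positivity, fun n hn => ⟨hlower n hn, ?_⟩⟩
    have hL : 0 < log n := by linarith
    have hn2 := two_le_of_eight_le_log hn
    have hc1 : 0 < c + 1 := by linarith
    have hl2 : 0 < log 2 := log_pos one_lt_two
    have hS := sum_log_rpow_div_le hc0
      (fun x hx => hasDerivAt_log_rpow_div hc1.ne' hx) hn2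
    have h1 : 1 ≤ log n ^ (c + 1) := one_le_rpow (by linarith) hc1.le
    have h2 : 0 ≤ log 2 ^ (c + 1) / (c + 1) := by positivity
    have h3 : log 2 ^ c / 2 * 1 ≤ log 2 ^ c / 2 * log n ^ (c + 1) := by gcongr
    calc Asum c n ≤ log n ^ (2 - c) * ∑ i ∈ Finset.Icc 2 n, log i ^ c / i :=
          Asum_le_of_nonpos hc0 hn2
      _ ≤ log n ^ (2 - c) * ((log 2 ^ c / 2 + 1 / (c + 1)) * log n ^ (c + 1)) := by
          refine mul_le_mul_of_nonneg_left (hS.trans ?_) (by positivity)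
          rw [add_mul, one_div_mul_eq_div]
          linarith
      _ = _ := by rw [← hpow n hn]; ring

theorem Asum_bounds_neg_one :
    ∃ a A : ℝ, 0 < a ∧ ∀ n : ℕ, 8 ≤ log n →
      a * (log n ^ 3 * log (log n)) ≤ Asum (-1) n ∧
        Asum (-1) n ≤ A * (log n ^ 3 * log (log n)) := by
  have hl2 : 0 < log 2 := log_pos one_lt_two
  have hll2 : log (log 2) ≤ 0 := log_nonpos hl2.le (by linarith [log_two_lt_d9])
  have hpow : ∀ x : ℝ, x ^ ((2 : ℝ) - -1) = x ^ 3 := by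
    intro x
    rw [← rpow_natCast]
    norm_num
  refine ⟨min 1 ((1 / 4 : ℝ) ^ (-(-1) : ℝ)) / 64 * (1 / 2),
    log 2 ^ (-1 : ℝ) / 2 - log (log 2) + 1, by positivity, fun n hn => ?_⟩
  have hL : 0 < log n := by linarith
  have hn2 := two_le_of_eight_le_log hn
  have hlog8 : log 8 ≤ log (log n) := log_le_log (by norm_num) hn
  have hlog8' : log 8 = 3 * log 2 := by
    rw [show (8 : ℝ) = 2 ^ 3 by norm_num, log_pow]; norm_num
  have hlog2 := log_two_gt_d9
  constructor
  · have h := sub_le_sum_Ioc_of_antitoneOn (fun x hx => hasDerivAt_log_log hx)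
      (antitoneOn_log_rpow_div (by norm_num : (-1 : ℝ) ≤ 0)) le_rfl
      (one_le_floorPow (by norm_num : (0 : ℝ) ≤ 1 / 2) n)
    have h1 : log (1 / 2 * log n) ≤ log (log (floorPow (1 / 2) n + 1)) :=
      log_le_log (by positivity) (mul_log_le_log_floorPow_add_one _ n)
    rw [log_mul (by norm_num) hL.ne', one_div, log_inv] at h1
    rw [show ((1 : ℕ) : ℝ) + 1 = 2 by norm_num] at h
    refine le_trans ?_ (le_Asum hn)
    rw [hpow, mul_mul_mul_comm]
    refine mul_le_mul_of_nonneg_left ?_ (by positivity)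
    rw [show Finset.Icc 2 (floorPow (1 / 2) n) = Finset.Ioc 1 (floorPow (1 / 2) n) from rfl]
    simp only [one_div] at *
    linarith
  · have hS := sum_log_rpow_div_le (by norm_num : (-1 : ℝ) ≤ 0)
      (fun x hx => hasDerivAt_log_log hx) hn2
    have h0 : 0 ≤ log 2 ^ (-1 : ℝ) / 2 - log (log 2) := by
      have : 0 ≤ log 2 ^ (-1 : ℝ) / 2 := by positivity
      linarith
    refine (Asum_le_of_nonpos (by norm_num) hn2).trans ?_
    rw [hpow, mul_left_comm]
    refine mul_le_mul_of_nonneg_left (hS.trans ?_) (by positivity)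
    nlinarith

theorem Asum_bounds_of_lt_neg_one {c : ℝ} (hc : c < -1) :
    ∃ a A : ℝ, 0 < a ∧ ∀ n : ℕ, 8 ≤ log n →
      a * log n ^ (2 - c) ≤ Asum c n ∧ Asum c n ≤ A * log n ^ (2 - c) := by
  have hl2 : 0 < log 2 := log_pos one_lt_two
  refine ⟨min 1 ((1 / 4 : ℝ) ^ (-c)) / 64 * (log 2 ^ c / 2),
    log 2 ^ c / 2 - log 2 ^ (c + 1) / (c + 1), by positivity, fun n hn => ?_⟩
  have hL : 0 < log n := by linarith
  have hn2 := two_le_of_eight_le_log hn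
  constructor
  · have hm : 2 ≤ floorPow (1 / 2) n := by
      refine Nat.le_floor ?_
      push_cast
      linarith [add_one_le_exp (1 / 2 * log n)]
    refine le_trans ?_ (le_Asum hn)
    rw [mul_right_comm]
    refine mul_le_mul_of_nonneg_left ?_ (by positivity)
    exact Finset.single_le_sum (f := fun i : ℕ => log i ^ c / i)
      (fun i _ => div_nonneg (rpow_nonneg (log_natCast_nonneg i) c) i.cast_nonneg)
      (Finset.mem_Icc.2 ⟨le_rfl, hm⟩)
  · have hS := sum_log_rpow_div_le (by linarith : c ≤ 0)
      (fun x hx => hasDerivAt_log_rpow_div (by linarith : c + 1 ≠ 0) hx) hn2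
    have h1 : log n ^ (c + 1) / (c + 1) ≤ 0 :=
      div_nonpos_of_nonneg_of_nonpos (by positivity) (by linarith)
    refine (Asum_le_of_nonpos (by linarith) hn2).trans ?_
    rw [mul_comm]
    refine mul_le_mul_of_nonneg_right (hS.trans ?_) (by positivity)
    linarith

theorem exists_eight_le_log : ∃ n₀ : ℕ, 4 ≤ n₀ ∧ ∀ n : ℕ, n₀ ≤ n → 8 ≤ log n := by
  refine ⟨max 4 ⌈exp 8⌉₊, le_max_left _ _, fun n hn => ?_⟩
  have h := Nat.ceil_le.1 ((le_max_right _ _).trans hn)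
  exact (le_log_iff_exp_le ((exp_pos _).trans_le h)).2 h

/-- Phase transition in the expected triangle count of the generalized preferential
attachment model: `A_n(c) ≍ (log n)³` for `c > -1`, `A_n(-1) ≍ (log n)³ log log n`,
and `A_n(c) ≍ (log n)^{2-c}` for `c < -1`. -/
theorem Asum_phase_transition (c : ℝ) :
    ∃ c₁ C₁ : ℝ, ∃ n₀ : ℕ, 0 < c₁ ∧ c₁ ≤ C₁ ∧ 4 ≤ n₀ ∧ ∀ n : ℕ, n₀ ≤ n →
      (-1 < c →
        c₁ * (Real.log n) ^ 3 ≤ Asum c n ∧ Asum c n ≤ C₁ * (Real.log n) ^ 3) ∧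
      (c = -1 →
        c₁ * (Real.log n) ^ 3 * Real.log (Real.log n) ≤ Asum c n ∧
        Asum c n ≤ C₁ * (Real.log n) ^ 3 * Real.log (Real.log n)) ∧
      (c < -1 →
        c₁ * (Real.log n) ^ (2 - c) ≤ Asum c n ∧
        Asum c n ≤ C₁ * (Real.log n) ^ (2 - c)) := by
  obtain ⟨n₀, hn₀, hlog⟩ := exists_eight_le_log
  rcases lt_trichotomy c (-1) with hc | hc | hc
  · obtain ⟨a, A, ha, h⟩ := Asum_bounds_of_lt_neg_one hc
    refine ⟨a, max a A, n₀, ha, le_max_left _ _, hn₀, fun n hn =>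
      ⟨fun h' => (lt_asymm hc h').elim, fun h' => (hc.ne h').elim, fun _ => ?_⟩⟩
    obtain ⟨h1, h2⟩ := h n (hlog n hn)
    exact ⟨h1, h2.trans (mul_le_mul_of_nonneg_right (le_max_right _ _)
      (rpow_nonneg (log_natCast_nonneg n) _))⟩
  · subst hc
    obtain ⟨a, A, ha, h⟩ := Asum_bounds_neg_one
    refine ⟨a, max a A, n₀, ha, le_max_left _ _, hn₀, fun n hn =>
      ⟨fun h' => (lt_irrefl _ h').elim, fun _ => ?_, fun h' => (lt_irrefl _ h').elim⟩⟩
    obtain ⟨h1, h2⟩ := h n (hlog n hn)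
    have hll : 0 ≤ log (log n) := log_nonneg (by linarith [hlog n hn])
    rw [mul_assoc, mul_assoc]
    exact ⟨h1, h2.trans (mul_le_mul_of_nonneg_right (le_max_right _ _)
      (mul_nonneg (pow_nonneg (log_natCast_nonneg n) 3) hll))⟩
  · obtain ⟨a, A, ha, h⟩ := Asum_bounds_of_neg_one_lt hc
    refine ⟨a, max a A, n₀, ha, le_max_left _ _, hn₀, fun n hn =>
      ⟨fun _ => ?_, fun h' => (hc.ne' h').elim, fun h' => (lt_asymm hc h').elim⟩⟩
    obtain ⟨h1, h2⟩ := h n (hlog n hn)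
    exact ⟨h1, h2.trans (mul_le_mul_of_nonneg_right (le_max_right _ _)
      (pow_nonneg (log_natCast_nonneg n) 3))⟩
end

section
/- Let α ∈ (0,1), c > 0, b ≥ 1 and L ≥ b be real numbers. Then b^{2α} · ∫₀^{(L−b)/b^α} u e^{−cu} du ≤ ∫₀^{L−b} u · exp( −(c/(1−α)) · ((b+u)^{1−α} − b^{1−α}) ) du ≤ b^{2α} · ∫₀^{∞} u · exp( −c u/(1 + u^α) ) du, and the rightmost integral is finite. -/
open Real MeasureTheory

/-- The tangent line of the concave power function `x ↦ x ^ p`, `0 ≤ p ≤ 1`, lies above it. -/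
theorem rpow_le_tangent_line {p x y : ℝ} (hp0 : 0 ≤ p) (hp1 : p ≤ 1) (hx : 0 < x) (hy : 0 ≤ y) :
    y ^ p ≤ x ^ p + p * x ^ (p - 1) * (y - x) := by
  have hs : -1 ≤ (y - x) / x := by
    rw [le_div_iff₀ hx]; linarith
  have h := mul_le_mul_of_nonneg_left (rpow_one_add_le_one_add_mul_self hs hp0 hp1)
    (Real.rpow_nonneg hx.le p)
  rw [← Real.mul_rpow hx.le (by linarith)] at h
  have e : x * (1 + (y - x) / x) = y := by field_simp; ring
  rw [e] at h
  refine h.trans_eq ?_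
  rw [Real.rpow_sub_one hx.ne']
  field_simp

/-- In the variable `v = u / b ^ α`, the increment of `x ↦ x ^ (1 - α)` from `b` to `b + u` is at
most `(1 - α) * v`. -/
theorem rpow_one_sub_increment_le {α b v : ℝ} (hα : α ∈ Set.Ioo (0 : ℝ) 1) (hb : 0 < b)
    (hv : 0 ≤ v) :
    (b + b ^ α * v) ^ (1 - α) - b ^ (1 - α) ≤ (1 - α) * v := by
  have hbα : 0 < b ^ α := Real.rpow_pos_of_pos hb α
  have h := rpow_le_tangent_line (p := 1 - α) (by linarith [hα.2]) (by linarith [hα.1]) hb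
    (add_nonneg hb.le (mul_nonneg hbα.le hv))
  have e : (1 - α) * b ^ (1 - α - 1) * (b + b ^ α * v - b) = (1 - α) * v := by
    rw [show 1 - α - 1 = -α by ring, Real.rpow_neg hb.le]
    field_simp
    ring
  linarith

/-- In the variable `v = u / b ^ α`, the increment of `x ↦ x ^ (1 - α)` from `b` to `b + u` is at
least `(1 - α) * v / (1 + v ^ α)`. -/
theorem le_rpow_one_sub_increment {α b v : ℝ} (hα : α ∈ Set.Ioo (0 : ℝ) 1) (hb : 1 ≤ b)
    (hv : 0 ≤ v) :
    (1 - α) * (v / (1 + v ^ α)) ≤ (b + b ^ α * v) ^ (1 - α) - b ^ (1 - α) := by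
  have hb0 : 0 < b := by linarith
  have hbα : 0 < b ^ α := Real.rpow_pos_of_pos hb0 α
  have hw : 0 < b + b ^ α * v := by positivity
  have h := rpow_le_tangent_line (p := 1 - α) (by linarith [hα.2]) (by linarith [hα.1]) hw hb0.le
  rw [show 1 - α - 1 = -α by ring, Real.rpow_neg hw.le] at h
  have hbound : (b + b ^ α * v) ^ α ≤ b ^ α * (1 + v ^ α) := by
    have hbb : b ^ α ≤ b := by
      simpa using Real.rpow_le_rpow_of_exponent_le hb hα.2.le
    calc (b + b ^ α * v) ^ α ≤ (b * (1 + v)) ^ α := by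
          apply Real.rpow_le_rpow hw.le _ hα.1.le
          nlinarith
      _ = b ^ α * (1 + v) ^ α := Real.mul_rpow hb0.le (by linarith)
      _ ≤ b ^ α * (1 + v ^ α) := by
          have := Real.rpow_add_le_add_rpow zero_le_one hv hα.1.le hα.2.le
          rw [Real.one_rpow] at this
          gcongr
  have hvα : 0 ≤ v ^ α := Real.rpow_nonneg hv α
  have hwα : 0 < (b + b ^ α * v) ^ α := Real.rpow_pos_of_pos hw α
  have key : v / (1 + v ^ α) ≤ ((b + b ^ α * v) ^ α)⁻¹ * (b ^ α * v) := by
    rw [← div_eq_inv_mul, div_le_div_iff₀ (by linarith) hwα]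
    nlinarith
  have := mul_le_mul_of_nonneg_left key (sub_nonneg.2 hα.2.le)
  linarith

/-- The function `u ↦ u * exp (-c * u / (1 + u ^ α))` is integrable on `(0, ∞)`. -/
theorem integrableOn_mul_exp_neg_mul_div_one_add_rpow {α c : ℝ} (hα : α ∈ Set.Ioo (0 : ℝ) 1)
    (hc : 0 < c) :
    IntegrableOn (fun u : ℝ => u * Real.exp (-c * u / (1 + u ^ α))) (Set.Ioi (0 : ℝ)) := by
  have hp : 0 < 1 - α := by linarith [hα.2]
  have hdom : IntegrableOn (fun u : ℝ => u ^ (1 : ℝ) * Real.exp (-(c / 2) * u ^ (1 - α)))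
      (Set.Ioi (0 : ℝ)) := by
    apply Integrable.of_integral_ne_zero
    rw [integral_rpow_mul_exp_neg_mul_rpow hp (by norm_num) (by positivity)]
    have := Real.Gamma_pos_of_pos (show 0 < (1 + 1) / (1 - α) by positivity)
    positivity
  refine (hdom.const_mul (Real.exp (c / 2))).mono' ?_ ?_
  · apply Measurable.aestronglyMeasurable
    fun_prop
  · refine (ae_restrict_iff' measurableSet_Ioi).2 (Filter.Eventually.of_forall fun u hu => ?_)
    have hu : 0 < u := hu
    have huα : 0 < u ^ α := Real.rpow_pos_of_pos hu α
    rw [Real.norm_of_nonneg (by positivity), Real.rpow_one, mul_left_comm, ← Real.exp_add]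
    gcongr
    rw [Real.rpow_sub hu, Real.rpow_one]
    rw [div_le_iff₀ (by linarith)]
    have e : (c / 2 + -(c / 2) * (u / u ^ α)) * (1 + u ^ α) - -c * u
        = c / 2 * ((1 + u ^ α) + u * (u ^ α - 1) / u ^ α) := by
      field_simp
      ring
    have h2 : 0 ≤ (1 + u ^ α) + u * (u ^ α - 1) / u ^ α := by
      rcases le_total 1 u with h1 | h1
      · have : 0 ≤ u ^ α - 1 := sub_nonneg.2 (Real.one_le_rpow h1 hα.1.le)
        positivity
      · have : u ≤ u ^ α := by
          simpa using Real.rpow_le_rpow_of_exponent_ge hu h1 hα.2.le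
        have h3 : -1 ≤ u * (u ^ α - 1) / u ^ α := by
          rw [le_div_iff₀ huα]
          nlinarith
        linarith
    have := mul_nonneg (by positivity : 0 ≤ c / 2) h2
    linarith

/-- Sandwich bound for the integral `∫₀^{L-b} u exp(-(c/(1-α))((b+u)^{1-α} - b^{1-α})) du`:
it is bounded below by `b^{2α} ∫₀^{(L-b)/b^α} u e^{-cu} du` and above by
`b^{2α} ∫₀^∞ u exp(-cu/(1+u^α)) du`, the latter integral being finite. -/
theorem triangle_integral_sandwich (α c b L : ℝ) (hα : α ∈ Set.Ioo (0 : ℝ) 1)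
    (hc : 0 < c) (hb : 1 ≤ b) (hL : b ≤ L) :
    (b ^ (2 * α) * ∫ u in (0 : ℝ)..((L - b) / b ^ α), u * Real.exp (-c * u)) ≤
      (∫ u in (0 : ℝ)..(L - b),
        u * Real.exp (-(c / (1 - α)) * ((b + u) ^ (1 - α) - b ^ (1 - α)))) ∧
    (∫ u in (0 : ℝ)..(L - b),
        u * Real.exp (-(c / (1 - α)) * ((b + u) ^ (1 - α) - b ^ (1 - α)))) ≤
      b ^ (2 * α) * ∫ u in Set.Ioi (0 : ℝ), u * Real.exp (-c * u / (1 + u ^ α)) ∧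
    IntegrableOn (fun u : ℝ => u * Real.exp (-c * u / (1 + u ^ α))) (Set.Ioi (0 : ℝ)) := by
  have hfin := integrableOn_mul_exp_neg_mul_div_one_add_rpow hα hc
  have hp : 0 < 1 - α := by linarith [hα.2]
  have hb0 : 0 < b := by linarith
  have hbα : 0 < b ^ α := Real.rpow_pos_of_pos hb0 α
  have hT : 0 ≤ (L - b) / b ^ α := div_nonneg (by linarith) hbα.le
  have hsq : b ^ (2 * α) = b ^ α * b ^ α := by rw [← Real.rpow_add hb0]; ring_nf
  have hsubst : (∫ u in (0 : ℝ)..(L - b),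
        u * Real.exp (-(c / (1 - α)) * ((b + u) ^ (1 - α) - b ^ (1 - α)))) =
      b ^ (2 * α) * ∫ v in (0 : ℝ)..((L - b) / b ^ α),
        v * Real.exp (-(c / (1 - α)) * ((b + b ^ α * v) ^ (1 - α) - b ^ (1 - α))) := by
    have h := intervalIntegral.mul_integral_comp_mul_left (a := 0) (b := (L - b) / b ^ α)
      (f := fun u => u * Real.exp (-(c / (1 - α)) * ((b + u) ^ (1 - α) - b ^ (1 - α)))) (b ^ α)
    rw [mul_zero, mul_div_cancel₀ _ hbα.ne'] at h
    rw [← h, hsq]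
    simp only [mul_assoc, intervalIntegral.integral_const_mul]
  have hmid : IntervalIntegrable (fun v : ℝ => v * Real.exp (-(c / (1 - α)) *
      ((b + b ^ α * v) ^ (1 - α) - b ^ (1 - α)))) volume 0 ((L - b) / b ^ α) := by
    apply Continuous.intervalIntegrable
    have : Continuous fun v : ℝ => (b + b ^ α * v) ^ (1 - α) :=
      (by fun_prop : Continuous fun v : ℝ => b + b ^ α * v).rpow_const fun _ => Or.inr hp.le
    fun_prop
  have hcp : 0 < c / (1 - α) := div_pos hc hp
  have hcancel : c / (1 - α) * (1 - α) = c := div_mul_cancel₀ _ hp.ne'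
  rw [hsubst]
  refine ⟨?_, ?_, hfin⟩
  · refine mul_le_mul_of_nonneg_left (intervalIntegral.integral_mono_on hT
      (Continuous.intervalIntegrable (by fun_prop) _ _) hmid fun v hv => ?_) (by positivity)
    have h := mul_le_mul_of_nonneg_left (rpow_one_sub_increment_le hα hb0 hv.1) hcp.le
    rw [← mul_assoc, hcancel] at h
    exact mul_le_mul_of_nonneg_left (Real.exp_le_exp.2 (by linarith)) hv.1
  · refine mul_le_mul_of_nonneg_left ?_ (by positivity)
    have hsub : Set.Ioc 0 ((L - b) / b ^ α) ⊆ Set.Ioi (0 : ℝ) := fun _ hx => hx.1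
    rw [intervalIntegral.integral_of_le hT]
    refine (setIntegral_mono_on ((intervalIntegrable_iff_integrableOn_Ioc_of_le hT).1 hmid)
      (hfin.mono_set hsub) measurableSet_Ioc fun v hv => ?_).trans
      (setIntegral_mono_set hfin ?_ hsub.eventuallyLE)
    · have h := mul_le_mul_of_nonneg_left (le_rpow_one_sub_increment hα hb hv.1.le) hcp.le
      rw [← mul_assoc, hcancel] at h
      refine mul_le_mul_of_nonneg_left (Real.exp_le_exp.2 ?_) hv.1.le
      rw [neg_mul c v, neg_div, mul_div_assoc]
      linarith
    · refine (ae_restrict_iff' measurableSet_Ioi).2 (Filter.Eventually.of_forall fun u hu => ?_)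
      exact mul_nonneg (le_of_lt hu) (Real.exp_nonneg _)
end

section
/- Let α ∈ (0,1) and κ > 0, and define F(x) := ∫₀ˣ exp( κ y^{1−α} ) dy for x > 0. Then there exist constants 0 < c₁ ≤ C₁ and x₀ > 0, depending only on α and κ, such that for all x ≥ x₀: c₁ · x^α · exp( κ x^{1−α} ) ≤ F(x) ≤ C₁ · x^α · exp( κ x^{1−α} ). -/
open Real

/-- If `f a ≤ g a` and `f' ≤ g'` on `[a, ∞)`, then `f ≤ g` on `[a, ∞)`. -/
lemma le_of_hasDerivAt_le {f g f' g' : ℝ → ℝ} {a : ℝ}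
    (hf : ∀ y, a ≤ y → HasDerivAt f (f' y) y) (hg : ∀ y, a ≤ y → HasDerivAt g (g' y) y)
    (ha : f a ≤ g a) (hle : ∀ y, a ≤ y → f' y ≤ g' y) {x : ℝ} (hx : a ≤ x) : f x ≤ g x := by
  have hd : ∀ y, a ≤ y → HasDerivAt (g - f) (g' y - f' y) y := fun y hy =>
    (hg y hy).sub (hf y hy)
  have hmono : MonotoneOn (g - f) (Set.Ici a) := by
    refine monotoneOn_of_deriv_nonneg (convex_Ici a)
      (fun y hy => (hd y hy).continuousAt.continuousWithinAt) ?_ ?_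
    · exact fun y hy =>
        (hd y (interior_subset hy)).differentiableAt.differentiableWithinAt
    · intro y hy
      rw [(hd y (interior_subset hy)).deriv]
      exact sub_nonneg.2 (hle y (interior_subset hy))
  have h := hmono Set.self_mem_Ici (Set.mem_Ici.2 hx) hx
  simp only [Pi.sub_apply] at h
  linarith

lemma hasDerivAt_rpow_mul_exp_rpow (α κ : ℝ) {y : ℝ} (hy : 0 < y) :
    HasDerivAt (fun y : ℝ => y ^ α * exp (κ * y ^ (1 - α)))
      ((α * y ^ (α - 1) + κ * (1 - α)) * exp (κ * y ^ (1 - α))) y := by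
  have h1 := hasDerivAt_rpow_const (x := y) (p := α) (Or.inl hy.ne')
  have h2 := ((hasDerivAt_rpow_const (x := y) (p := 1 - α) (Or.inl hy.ne')).const_mul κ).exp
  refine (h1.mul h2).congr_deriv ?_
  have h3 : y ^ α * y ^ (1 - α - 1) = 1 := by
    rw [← rpow_add hy]; simp
  linear_combination (κ * (1 - α) * exp (κ * y ^ (1 - α))) * h3

/-- For `α ∈ (0,1)` and `κ > 0`, `F(x) = ∫₀ˣ exp(κ y^{1-α}) dy ≍ x^α exp(κ x^{1-α})`
as `x → ∞`. -/
theorem exp_rpow_integral_asymptotics (α κ : ℝ) (hα : α ∈ Set.Ioo (0 : ℝ) 1) (hκ : 0 < κ) :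
    ∃ c₁ C₁ x₀ : ℝ, 0 < c₁ ∧ c₁ ≤ C₁ ∧ 0 < x₀ ∧ ∀ x : ℝ, x₀ ≤ x →
      c₁ * x ^ α * Real.exp (κ * x ^ (1 - α)) ≤
        (∫ y in (0 : ℝ)..x, Real.exp (κ * y ^ (1 - α))) ∧
      (∫ y in (0 : ℝ)..x, Real.exp (κ * y ^ (1 - α))) ≤
        C₁ * x ^ α * Real.exp (κ * x ^ (1 - α)) := by
  obtain ⟨hα0, hα1⟩ := hα
  have hβ : 0 < 1 - α := sub_pos.2 hα1
  have hb : 0 < κ * (1 - α) := mul_pos hκ hβ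
  have hcont : Continuous fun y : ℝ => exp (κ * y ^ (1 - α)) :=
    ((continuous_rpow_const hβ.le).const_mul κ).rexp
  have hF : ∀ y, 1 ≤ y → HasDerivAt (fun x => ∫ y in (0 : ℝ)..x, exp (κ * y ^ (1 - α)))
      (exp (κ * y ^ (1 - α))) y := fun y _ => (hcont.integral_hasStrictDerivAt 0 y).hasDerivAt
  have hG : ∀ c y : ℝ, 1 ≤ y → HasDerivAt (fun y : ℝ => c * (y ^ α * exp (κ * y ^ (1 - α))))
      (c * ((α * y ^ (α - 1) + κ * (1 - α)) * exp (κ * y ^ (1 - α)))) y := fun c y hy =>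
    (hasDerivAt_rpow_mul_exp_rpow α κ (zero_lt_one.trans_le hy)).const_mul c
  have hF1 : 1 ≤ ∫ y in (0 : ℝ)..1, exp (κ * y ^ (1 - α)) := by
    have h := intervalIntegral.integral_mono_on (μ := MeasureTheory.volume) zero_le_one
      (continuous_const (y := (1 : ℝ)).intervalIntegrable 0 1) (hcont.intervalIntegrable 0 1)
      fun y hy => one_le_exp (mul_nonneg hκ.le (rpow_nonneg hy.1 _))
    simpa using h
  have hF1' : ∫ y in (0 : ℝ)..1, exp (κ * y ^ (1 - α)) ≤ exp κ := by
    have h := intervalIntegral.integral_mono_on (μ := MeasureTheory.volume) zero_le_one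
      (hcont.intervalIntegrable 0 1) (continuous_const (y := exp κ).intervalIntegrable 0 1)
      fun y hy => exp_le_exp.2 (mul_le_of_le_one_right hκ.le (rpow_le_one hy.1 hy.2 hβ.le))
    simpa using h
  have hD : 0 < 1 + α + κ * (1 - α) := by positivity
  have hE : exp (-κ) ≤ 1 := exp_le_one_iff.2 (by linarith)
  have hC : 1 ≤ 1 + 1 / (κ * (1 - α)) := le_add_of_nonneg_right (by positivity)
  have hc : exp (-κ) / (1 + α + κ * (1 - α)) ≤ exp (-κ) :=
    div_le_self (exp_pos _).le (by linarith)
  refine ⟨exp (-κ) / (1 + α + κ * (1 - α)), 1 + 1 / (κ * (1 - α)), 1, by positivity,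
    hc.trans (hE.trans hC), one_pos, fun x hx => ?_⟩
  simp only [mul_assoc _ (x ^ α)]
  constructor
  · refine le_of_hasDerivAt_le (hG _) hF ?_ (fun y hy => ?_) hx
    · refine le_trans ?_ hF1
      simp only [one_rpow, mul_one, one_mul]
      calc _ ≤ exp (-κ) * exp κ := by gcongr
        _ = 1 := by rw [← exp_add]; simp
    · rw [← mul_assoc]
      refine mul_le_of_le_one_left (exp_pos _).le ?_
      rw [div_mul_eq_mul_div, div_le_one hD]
      have hy0 : 0 ≤ y := zero_le_one.trans hy
      have hp : y ^ (α - 1) ≤ 1 := rpow_le_one_of_one_le_of_nonpos hy (by linarith)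
      have hα' : α * y ^ (α - 1) ≤ α := mul_le_of_le_one_right hα0.le hp
      refine (mul_le_of_le_one_left (by positivity) hE).trans (by linarith)
  · refine le_of_hasDerivAt_le hF (hG _) ?_ (fun y hy => ?_) hx
    · refine hF1'.trans ?_
      simp only [one_rpow, mul_one, one_mul]
      exact le_mul_of_one_le_left (exp_pos _).le hC
    · rw [← mul_assoc]
      refine le_mul_of_one_le_left (exp_pos _).le ?_
      have hy0 : 0 ≤ y := zero_le_one.trans hy
      calc (1 : ℝ) ≤ 1 + κ * (1 - α) := by linarith
        _ = (1 + 1 / (κ * (1 - α))) * (κ * (1 - α)) := by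
          rw [add_mul, one_mul, one_div_mul_cancel hb.ne', add_comm]
        _ ≤ _ := by
          gcongr
          exact le_add_of_nonneg_left (by positivity)
end

section
/- Fix an integer m ≥ 2 and a real δ > −m; set a := m+δ and b_t := (2m+δ)(t−1) − m for integers t ≥ 2, and let M_{p,q}(a,b) := Γ(a+p)Γ(b+q)Γ(a+b)/(Γ(a)Γ(b)Γ(a+b+p+q)) denote the mixed moments E[ψ^p(1−ψ)^q] of a Beta(a,b) variable ψ. Then there exists a constant C > 0, depending only on m and δ, such that for all integers 2 ≤ t ≤ t': (i) M_{4,0}(a,b_t)/M_{2,0}(a,b_t)² − 1 ≤ C; (ii) M_{0,4}(a,b_t)/M_{0,2}(a,b_t)² − 1 ≤ C/t²; (iii) M_{2,2}(a,b_t)/M_{1,1}(a,b_t)² − 1 ≤ C; (iv) | M_{1,3}(a,b_t)/( M_{0,2}(a,b_t) · M_{1,1}(a,b_t) ) − 1 | ≤ C/t; and (v) ∏_{i=t}^{t'} M_{0,4}(a,b_i)/M_{0,2}(a,b_i)² ≤ C. -/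
open Real

/-- Mixed moment `E[ψ^p (1-ψ)^q]` of a `Beta(a,b)` random variable, as a ratio of
Gamma values: `M_{p,q}(a,b) = Γ(a+p)Γ(b+q)Γ(a+b)/(Γ(a)Γ(b)Γ(a+b+p+q))`. -/
noncomputable def Mmom (p q a b : ℝ) : ℝ :=
  Real.Gamma (a + p) * Real.Gamma (b + q) * Real.Gamma (a + b) /
    (Real.Gamma a * Real.Gamma b * Real.Gamma (a + b + p + q))

/-- The second Beta parameter `b_t = (2m+δ)(t-1) - m` in `PAM_n(m,δ)`. -/
noncomputable def bParam (m : ℕ) (δ : ℝ) (t : ℕ) : ℝ :=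
  (2 * (m : ℝ) + δ) * ((t : ℝ) - 1) - (m : ℝ)

lemma Gamma_add_natCast_eq_prod {x : ℝ} (hx : 0 < x) (n : ℕ) :
    Real.Gamma (x + n) = (∏ i ∈ Finset.range n, (x + i)) * Real.Gamma x := by
  induction n with
  | zero => simp
  | succ n ih =>
    have h : x + n ≠ 0 := by positivity
    rw [Nat.cast_succ, ← add_assoc, Real.Gamma_add_one h, ih, Finset.prod_range_succ]
    ring

lemma Mmom_natCast {a b : ℝ} (ha : 0 < a) (hb : 0 < b) (p q : ℕ) :
    Mmom p q a b = (∏ i ∈ Finset.range p, (a + i)) * (∏ i ∈ Finset.range q, (b + i)) /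
      ∏ i ∈ Finset.range (p + q), (a + b + i) := by
  have hs : 0 < a + b := add_pos ha hb
  have h := Gamma_add_natCast_eq_prod hs (p + q)
  rw [Nat.cast_add, ← add_assoc] at h
  rw [Mmom, h, Gamma_add_natCast_eq_prod ha, Gamma_add_natCast_eq_prod hb]
  have h1 := (Real.Gamma_pos_of_pos ha).ne'
  have h2 := (Real.Gamma_pos_of_pos hb).ne'
  have h3 := (Real.Gamma_pos_of_pos hs).ne'
  have h4 : ∏ i ∈ Finset.range (p + q), (a + b + i) ≠ 0 :=
    Finset.prod_ne_zero_iff.2 fun i _ => by positivity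
  field_simp

section Ratios

variable {a b : ℝ}

lemma Mmom_four_zero_div_sq (ha : 0 < a) (hb : 0 < b) :
    Mmom 4 0 a b / Mmom 2 0 a b ^ 2 = (a + 2) * (a + 3) * ((a + b) * (a + b + 1)) /
      (a * (a + 1) * ((a + b + 2) * (a + b + 3))) := by
  have h1 := Mmom_natCast ha hb 4 0
  have h2 := Mmom_natCast ha hb 2 0
  norm_num [Finset.prod_range_succ] at h1 h2
  rw [h1, h2]
  field_simp

lemma Mmom_zero_four_div_sq (ha : 0 < a) (hb : 0 < b) :
    Mmom 0 4 a b / Mmom 0 2 a b ^ 2 = (b + 2) * (b + 3) * ((a + b) * (a + b + 1)) /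
      (b * (b + 1) * ((a + b + 2) * (a + b + 3))) := by
  have h1 := Mmom_natCast ha hb 0 4
  have h2 := Mmom_natCast ha hb 0 2
  norm_num [Finset.prod_range_succ] at h1 h2
  rw [h1, h2]
  field_simp

lemma Mmom_two_two_div_sq (ha : 0 < a) (hb : 0 < b) :
    Mmom 2 2 a b / Mmom 1 1 a b ^ 2 = (a + 1) * (b + 1) * ((a + b) * (a + b + 1)) /
      (a * b * ((a + b + 2) * (a + b + 3))) := by
  have h1 := Mmom_natCast ha hb 2 2
  have h2 := Mmom_natCast ha hb 1 1
  norm_num [Finset.prod_range_succ] at h1 h2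
  rw [h1, h2]
  field_simp

lemma Mmom_one_three_div_mul (ha : 0 < a) (hb : 0 < b) :
    Mmom 1 3 a b / (Mmom 0 2 a b * Mmom 1 1 a b) = (b + 2) * ((a + b) * (a + b + 1)) /
      (b * ((a + b + 2) * (a + b + 3))) := by
  have h1 := Mmom_natCast ha hb 1 3
  have h2 := Mmom_natCast ha hb 0 2
  have h3 := Mmom_natCast ha hb 1 1
  norm_num [Finset.prod_range_succ] at h1 h2 h3
  rw [h1, h2, h3]
  field_simp

lemma Mmom_four_zero_div_sq_le (ha : 0 < a) (hb : 0 < b) :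
    Mmom 4 0 a b / Mmom 2 0 a b ^ 2 ≤ (a + 2) * (a + 3) / (a * (a + 1)) := by
  rw [Mmom_four_zero_div_sq ha hb, mul_div_mul_comm]
  refine mul_le_of_le_one_right (by positivity) ((div_le_one (by positivity)).2 ?_)
  nlinarith

lemma Mmom_zero_four_div_sq_sub_one_le (ha : 0 < a) (hb : 0 < b) :
    Mmom 0 4 a b / Mmom 0 2 a b ^ 2 - 1 ≤ 6 * a / b ^ 2 := by
  have h : Mmom 0 4 a b / Mmom 0 2 a b ^ 2 - 1 =
      a * (4 * b * (a + b) + 6 * (a + b + b) + 6) /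
        (b * (b + 1) * ((a + b + 2) * (a + b + 3))) := by
    rw [Mmom_zero_four_div_sq ha hb]
    field_simp
    ring
  have h6 : 4 * b * (a + b) + 6 * (a + b + b) + 6 ≤ 6 * ((b + 1) * (a + b + 3)) := by
    nlinarith [mul_pos ha hb]
  calc _ ≤ a * (6 * ((b + 1) * (a + b + 3))) / (b * (b + 1) * ((a + b + 2) * (a + b + 3))) := by
        rw [h]; gcongr
    _ = 6 * a / (b * (a + b + 2)) := by field_simp
    _ ≤ 6 * a / b ^ 2 := by
        rw [sq]; gcongr; linarith

lemma Mmom_two_two_div_sq_le (ha : 0 < a) (hb : 0 < b) :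
    Mmom 2 2 a b / Mmom 1 1 a b ^ 2 ≤ (a + 1) * (b + 1) / (a * b) := by
  rw [Mmom_two_two_div_sq ha hb, mul_div_mul_comm]
  refine mul_le_of_le_one_right (by positivity) ((div_le_one (by positivity)).2 ?_)
  nlinarith

lemma abs_Mmom_one_three_div_mul_sub_one_le (ha : 0 < a) (hb : 0 < b) :
    |Mmom 1 3 a b / (Mmom 0 2 a b * Mmom 1 1 a b) - 1| ≤ 6 / b := by
  have h : Mmom 1 3 a b / (Mmom 0 2 a b * Mmom 1 1 a b) - 1 =
      (2 * (a + b) * (a + b + 1) - b * (4 * (a + b) + 6)) /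
        (b * ((a + b + 2) * (a + b + 3))) := by
    rw [Mmom_one_three_div_mul ha hb]
    field_simp
    ring
  have hD : 0 < b * ((a + b + 2) * (a + b + 3)) := by positivity
  have h6 : 6 / b = 6 * ((a + b + 2) * (a + b + 3)) / (b * ((a + b + 2) * (a + b + 3))) := by
    field_simp
  rw [h, abs_div, abs_of_pos hD, h6]
  gcongr
  rw [abs_le]
  have := mul_pos ha hb
  constructor <;> nlinarith

end Ratios

lemma mul_div_two_le_bParam {m : ℕ} {δ : ℝ} (hδ : -(m : ℝ) < δ) {t : ℕ} (ht : 2 ≤ t) :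
    ((m : ℝ) + δ) * t / 2 ≤ bParam m δ t := by
  have ht' : (2 : ℝ) ≤ t := by exact_mod_cast ht
  have hm : (0 : ℝ) ≤ m := Nat.cast_nonneg m
  unfold bParam
  nlinarith [mul_nonneg hm (sub_nonneg.2 ht')]

/-- Uniform bounds on variances and covariances of the normalized Beta variables
`X_t, Y_t, U_t`: `Var(X_t) ≤ C`, `Var(Y_t) ≤ C/t²`, `Var(U_t) ≤ C`,
`Cov(Y_t,U_t) ≤ C/t`, and `∏_{i=t}^{t'} E Y_i² ≤ C`. -/
theorem normalized_beta_moment_bounds (m : ℕ) (hm : 2 ≤ m) (δ : ℝ) (hδ : -(m : ℝ) < δ) :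
    ∃ C : ℝ, 0 < C ∧ ∀ t t' : ℕ, 2 ≤ t → t ≤ t' →
      (Mmom 4 0 ((m : ℝ) + δ) (bParam m δ t) / (Mmom 2 0 ((m : ℝ) + δ) (bParam m δ t)) ^ 2
        - 1 ≤ C) ∧
      (Mmom 0 4 ((m : ℝ) + δ) (bParam m δ t) / (Mmom 0 2 ((m : ℝ) + δ) (bParam m δ t)) ^ 2
        - 1 ≤ C / (t : ℝ) ^ 2) ∧
      (Mmom 2 2 ((m : ℝ) + δ) (bParam m δ t) / (Mmom 1 1 ((m : ℝ) + δ) (bParam m δ t)) ^ 2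
        - 1 ≤ C) ∧
      (|Mmom 1 3 ((m : ℝ) + δ) (bParam m δ t) /
          (Mmom 0 2 ((m : ℝ) + δ) (bParam m δ t) * Mmom 1 1 ((m : ℝ) + δ) (bParam m δ t))
        - 1| ≤ C / (t : ℝ)) ∧
      (∏ i ∈ Finset.Icc t t',
          Mmom 0 4 ((m : ℝ) + δ) (bParam m δ i) / (Mmom 0 2 ((m : ℝ) + δ) (bParam m δ i)) ^ 2
        ≤ C) := by
  set a : ℝ := (m : ℝ) + δ
  have ha : 0 < a := by linarith
  have hbt : ∀ t : ℕ, 2 ≤ t → a * t / 2 ≤ bParam m δ t := fun t ht =>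
    mul_div_two_le_bParam hδ ht
  have hb : ∀ t : ℕ, 2 ≤ t → 0 < bParam m δ t := fun t ht =>
    lt_of_lt_of_le (by positivity) (hbt t ht)
  have hY : ∀ t : ℕ, 2 ≤ t →
      Mmom 0 4 a (bParam m δ t) / Mmom 0 2 a (bParam m δ t) ^ 2 - 1 ≤ 24 / a / (t : ℝ) ^ 2 := by
    intro t ht
    have ht0 : (0 : ℝ) < t := by positivity
    calc _ ≤ 6 * a / bParam m δ t ^ 2 := Mmom_zero_four_div_sq_sub_one_le ha (hb t ht)
      _ ≤ 6 * a / (a * t / 2) ^ 2 := by gcongr; exact hbt t ht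
      _ = 24 / a / (t : ℝ) ^ 2 := by field_simp; norm_num
  set S : ℝ := ∑' i : ℕ, 24 / a / (i : ℝ) ^ 2
  have hsum : Summable fun i : ℕ => 24 / a / (i : ℝ) ^ 2 := by
    simpa only [mul_one_div] using
      (Real.summable_one_div_nat_pow.2 one_lt_two).mul_left (24 / a)
  have h1 : 0 < (a + 2) * (a + 3) / (a * (a + 1)) := by positivity
  have h2 : 0 < 24 / a := by positivity
  have h3 : 0 < ((a + 1) / a) ^ 2 := by positivity
  have h4 : 0 < Real.exp S := Real.exp_pos S
  refine ⟨(a + 2) * (a + 3) / (a * (a + 1)) + 24 / a + ((a + 1) / a) ^ 2 + Real.exp S,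
    by positivity, fun t t' ht _ => ⟨?_, ?_, ?_, ?_, ?_⟩⟩
  · linarith [Mmom_four_zero_div_sq_le ha (hb t ht)]
  · refine (hY t ht).trans ?_
    gcongr
    linarith
  · have hab : a ≤ bParam m δ t := by
      have : (2 : ℝ) ≤ t := by exact_mod_cast ht
      nlinarith [hbt t ht]
    have hle : (a + 1) * (bParam m δ t + 1) / (a * bParam m δ t) ≤ ((a + 1) / a) ^ 2 := by
      have := hb t ht
      rw [mul_div_mul_comm, sq]
      gcongr ?_ * ?_
      rw [div_le_div_iff₀ this ha]
      linarith
    linarith [Mmom_two_two_div_sq_le ha (hb t ht)]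
  · have ht0 : (0 : ℝ) < t := by positivity
    calc _ ≤ 6 / bParam m δ t := abs_Mmom_one_three_div_mul_sub_one_le ha (hb t ht)
      _ ≤ 6 / (a * t / 2) := by gcongr; exact hbt t ht
      _ = 12 / a / t := by field_simp; norm_num
      _ ≤ _ := by
        gcongr
        have : 12 / a ≤ 24 / a := by gcongr; norm_num
        linarith
  · calc _ ≤ ∏ i ∈ Finset.Icc t t', Real.exp (24 / a / (i : ℝ) ^ 2) := by
          refine Finset.prod_le_prod (fun i hi => ?_) fun i hi => ?_
          · have := hb i (ht.trans (Finset.mem_Icc.1 hi).1)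
            rw [Mmom_zero_four_div_sq ha this]
            positivity
          · linarith [hY i (ht.trans (Finset.mem_Icc.1 hi).1),
              Real.add_one_le_exp (24 / a / (i : ℝ) ^ 2)]
      _ ≤ Real.exp S := by
          rw [← Real.exp_sum, Real.exp_le_exp]
          exact hsum.sum_le_tsum _ fun i _ => by positivity
      _ ≤ _ := by linarith
end
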